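/- arXiv:alg-geom/9312004 — 2 statements merged into one kernel-verified Lean document; each statement's English description precedes it below -/
import Mathlib

section
/- Let C be a smooth connected projective complex curve of genus g, L a very ample line bundle with deg L ≥ g+3 giving a projectively normal embedding, and D = P_1 + ... + P_d a divisor of d distinct points of degree d = deg L − g − 1 + 2h^1(L) such that |D| and |L(-D)| are base-point free of dimensions deg L − 2g + 4h^1(L) − 1 and 1 respectively, h^1(L(D)) = h^1(L^2(-D)) = 0, and any h^1(L) points of D impose independent conditions on K ⊗ L^{-1}(D). Then: (1) the natural map H^0(L) ⊗ H^0(D) → H^0(L(D)) is surjective; (2) if M_D is the vector bundle defined by the exact sequence 0 → M_D → H^0(D) ⊗ O_C → O(D) → 0 (evaluation of sections), then M_D ⊗ L is generated by its global sections. -/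
open TensorProduct Function

noncomputable section


/-!  ### Graded algebras presented by their components

An ℕ-graded algebra `R = ⊕ₙ Rₙ` over a field `k` (with `R₀ = k`) is presented here through
its graded components, realized as `k`-subspaces `piece n` of an ambient `k`-algebra `A`,
with `1 ∈ piece 0` and `piece m * piece n ⊆ piece (m + n)`.  All notions below (Koszulness,
quadraticity) depend only on the components and the componentwise multiplication maps. -/
structure GradedSystem (k A : Type) [Field k] [Ring A] [Algebra k A] where
  piece : ℕ → Submodule k A
  one_mem : (1 : A) ∈ piece 0
  mul_mem : ∀ {m n : ℕ} {x y : A}, x ∈ piece m → y ∈ piece n → x * y ∈ piece (m + n)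

namespace GradedSystem

variable {k A : Type} [Field k] [Ring A] [Algebra k A] (S : GradedSystem k A)

/-- The componentwise multiplication map `Rₘ ⊗ Rₙ → R_{m+n}`. -/
def mulMap (m n : ℕ) : S.piece m →ₗ[k] S.piece n →ₗ[k] S.piece (m + n) :=
  LinearMap.mk₂ k (fun x y => ⟨(x : A) * (y : A), S.mul_mem x.2 y.2⟩)
    (fun x x' y => Subtype.ext (by simp [add_mul]))
    (fun c x y => Subtype.ext (by simp [smul_mul_assoc]))
    (fun x y y' => Subtype.ext (by simp [mul_add]))
    (fun c x y => Subtype.ext (by simp [mul_smul_comm]))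

/-- Transport of a graded component along an equality of degrees. -/
def cast {m n : ℕ} (h : m = n) : (S.piece m : Type) ≃ₗ[k] S.piece n :=
  LinearEquiv.ofEq _ _ (by rw [h])

/-- The degree-`d` component of the differential
`V_{i+1} ⊗ R(-(i+1)) → V_i ⊗ R(-i)` of a complex of free graded (right) `R`-modules with
`V_i = k^{n i}` generated in degree `i`; the differential is encoded by its
restriction `φ i : V_{i+1} → V_i ⊗ R₁` to the generators (a "matrix of linear forms").
The degree-`(i+1+d)` component of the map is `V_{i+1} ⊗ R_d → V_i ⊗ R_{d+1}`. -/
def Dmap (n : ℕ → ℕ)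
    (φ : ∀ i : ℕ, (Fin (n (i + 1)) → k) →ₗ[k] ((Fin (n i) → k) ⊗[k] S.piece 1))
    (i d : ℕ) :
    ((Fin (n (i + 1)) → k) ⊗[k] S.piece d) →ₗ[k] ((Fin (n i) → k) ⊗[k] S.piece (d + 1)) :=
  (LinearMap.lTensor (Fin (n i) → k)
      ((S.cast (add_comm 1 d)).toLinearMap ∘ₗ TensorProduct.lift (S.mulMap 1 d))) ∘ₗ
    (TensorProduct.assoc k (Fin (n i) → k) (S.piece 1) (S.piece d)).toLinearMap ∘ₗ
    (LinearMap.rTensor (S.piece d) (φ i))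

/-- `S` is connected: the degree-zero component is spanned by the unit, i.e. `R₀ = k`. -/
def ConnectedOne : Prop := S.piece 0 = Submodule.span k {(1 : A)}

/-- `S` is a *Koszul algebra*: `R₀ = k` and the trivial module `k` admits a linear free
resolution `⋯ → V₂ ⊗ R(-2) → V₁ ⊗ R(-1) → R → k → 0` (this is one of the standard
equivalent definitions of Koszulness: `Extⁿ(k, k(-m)) = 0` for `n ≠ m`).
Exactness is expressed by its graded components: surjectivity of `V₁ ⊗ R_d → R_{d+1}`
(exactness at `R` in positive degrees), injectivity of `V_{i+1} ⊗ R₀ → V_i ⊗ R₁`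
(exactness in the lowest degree at each spot), and `range = ker` elsewhere. -/
def IsKoszul : Prop :=
  S.ConnectedOne ∧
  ∃ (n : ℕ → ℕ)
    (φ : ∀ i : ℕ, (Fin (n (i + 1)) → k) →ₗ[k] ((Fin (n i) → k) ⊗[k] S.piece 1)),
    n 0 = 1 ∧
    (∀ d : ℕ, Surjective (S.Dmap n φ 0 d)) ∧
    (∀ i : ℕ, Injective (S.Dmap n φ i 0)) ∧
    (∀ i d : ℕ, LinearMap.range (S.Dmap n φ (i + 1) d) = LinearMap.ker (S.Dmap n φ i (d + 1)))

/-- `S` is a *quadratic algebra*: `R₀ = k`, `R` is generated by `R₁` and its relations are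
generated in degree `2`; equivalently there is an exact sequence
`V₂ ⊗ R(-2) → V₁ ⊗ R(-1) → R → k → 0` (exact at `V₁ ⊗ R(-1)` and at `R`). -/
def IsQuadratic : Prop :=
  S.ConnectedOne ∧
  ∃ (n : ℕ → ℕ)
    (φ : ∀ i : ℕ, (Fin (n (i + 1)) → k) →ₗ[k] ((Fin (n i) → k) ⊗[k] S.piece 1)),
    n 0 = 1 ∧
    (∀ d : ℕ, Surjective (S.Dmap n φ 0 d)) ∧
    Injective (S.Dmap n φ 0 0) ∧
    (∀ d : ℕ, LinearMap.range (S.Dmap n φ 1 d) = LinearMap.ker (S.Dmap n φ 0 (d + 1)))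

end GradedSystem

/-- For `m = 1`, the canonical identification `(k^m) ⊗ M ≃ M`. -/
def oneTensorEquiv {k : Type} [Field k] {m : ℕ} (h : m = 1) (M : Type)
    [AddCommGroup M] [Module k M] : ((Fin m → k) ⊗[k] M) ≃ₗ[k] M :=
  (TensorProduct.congr
      ((LinearEquiv.funCongrLeft k k (finCongr h.symm)).trans
        (LinearEquiv.funUnique (Fin 1) k k))
      (LinearEquiv.refl k M)).trans (TensorProduct.lid k M)


/-!  ### Smooth connected projective complex curves

A smooth connected projective curve over `ℂ` is (equivalently) presented through its
function field `F` — a finitely generated extension of `ℂ` of transcendence degree 1 —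
together with its set of points (= places of `F/ℂ`), each point giving an
order-of-vanishing valuation `ord P : F → ℤ`.  Divisors are finitely supported `ℤ`-valued
functions on points, and `H⁰(C, O(D))` is the Riemann–Roch space of `D`. -/
structure PreCurve where
  /-- the function field of the curve -/
  F : Type
  [fieldF : Field F]
  [algF : Algebra ℂ F]
  /-- `F` is a finitely generated extension of `ℂ` of transcendence degree 1 -/
  trdeg_one : ∃ x : F, Transcendental ℂ x ∧
    FiniteDimensional (IntermediateField.adjoin ℂ {x}) F
  /-- the (closed) points of the curve -/
  Point : Type
  /-- order of vanishing of a rational function at a point -/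
  ord : Point → F → ℤ
  ord_zero' : ∀ P, ord P 0 = 0
  ord_mul : ∀ P, ∀ f g : F, f ≠ 0 → g ≠ 0 → ord P (f * g) = ord P f + ord P g
  ord_add : ∀ P, ∀ f g : F, f ≠ 0 → g ≠ 0 → f + g ≠ 0 →
    min (ord P f) (ord P g) ≤ ord P (f + g)
  ord_algebraMap : ∀ P, ∀ c : ℂ, c ≠ 0 → ord P (algebraMap ℂ F c) = 0
  /-- every point admits a local uniformizer (the valuation is surjective) -/
  ord_uniformizer : ∀ P, ∃ f : F, f ≠ 0 ∧ ord P f = 1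
  /-- a nonzero rational function has only finitely many zeros and poles -/
  ord_finite_support : ∀ f : F, f ≠ 0 → (Function.support fun P => ord P f).Finite
  /-- distinct points are separated by rational functions -/
  ord_separates : ∀ P Q : Point, P ≠ Q → ∃ f : F, f ≠ 0 ∧ 0 < ord P f ∧ ord Q f = 0

attribute [instance] PreCurve.fieldF PreCurve.algF

namespace PreCurve

variable (C : PreCurve)

/-- Divisors on the curve. -/
abbrev Div := C.Point →₀ ℤ

/-- The divisor of a single point. -/
def pt (P : C.Point) : C.Div := Finsupp.single P 1

/-- The degree of a divisor. -/
def deg (D : C.Div) : ℤ := D.sum fun _ n => n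

/-- The Riemann–Roch space `H⁰(C, O(D)) = {f ∈ F | div f + D ≥ 0} ∪ {0}`. -/
def H0 (D : C.Div) : Submodule ℂ C.F where
  carrier := {f : C.F | f = 0 ∨ ∀ P, 0 ≤ C.ord P f + D P}
  zero_mem' := Or.inl rfl
  add_mem' := by
    intro f g hf hg
    rcases eq_or_ne f 0 with rfl | hf0
    · simpa using hg
    rcases eq_or_ne g 0 with rfl | hg0
    · simpa using hf
    rcases eq_or_ne (f + g) 0 with h0 | h0
    · exact Or.inl h0
    rcases hf with rfl | hf
    · exact absurd rfl hf0
    rcases hg with rfl | hg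
    · exact absurd rfl hg0
    refine Or.inr fun P => ?_
    have hmin := C.ord_add P f g hf0 hg0 h0
    rcases le_total (C.ord P f) (C.ord P g) with hle | hle
    · rw [min_eq_left hle] at hmin
      have := hf P; omega
    · rw [min_eq_right hle] at hmin
      have := hg P; omega
  smul_mem' := by
    intro c f hf
    rcases eq_or_ne c 0 with rfl | hc
    · exact Or.inl (zero_smul ℂ f)
    rcases hf with rfl | hf
    · exact Or.inl (smul_zero c)
    rcases eq_or_ne f 0 with rfl | hf0
    · exact Or.inl (smul_zero c)
    refine Or.inr fun P => ?_
    have hmap : (algebraMap ℂ C.F c) ≠ 0 := fun h =>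
      hc ((algebraMap ℂ C.F).injective (by rw [h, map_zero]))
    have hsm : c • f = algebraMap ℂ C.F c * f := Algebra.smul_def c f
    rw [hsm, C.ord_mul P _ f hmap hf0, C.ord_algebraMap P c hc]
    simpa using hf P

theorem mem_H0 {D : C.Div} {f : C.F} :
    f ∈ C.H0 D ↔ (f = 0 ∨ ∀ P, 0 ≤ C.ord P f + D P) := Iff.rfl

/-- `h⁰(D) = dim H⁰(C, O(D))`. -/
def h0 (D : C.Div) : ℕ := Module.finrank ℂ (C.H0 D)

theorem H0_mono {D E : C.Div} (h : ∀ P, D P ≤ E P) : C.H0 D ≤ C.H0 E := by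
  intro f hf
  rcases (C.mem_H0.mp hf) with rfl | hf
  · exact (C.H0 E).zero_mem
  · exact C.mem_H0.mpr (Or.inr fun P => by have := h P; have := hf P; omega)

theorem mul_mem_H0 {D E : C.Div} {f g : C.F} (hf : f ∈ C.H0 D) (hg : g ∈ C.H0 E) :
    f * g ∈ C.H0 (D + E) := by
  rcases (C.mem_H0.mp hf) with rfl | hf
  · exact C.mem_H0.mpr (Or.inl (zero_mul g))
  rcases (C.mem_H0.mp hg) with rfl | hg
  · exact C.mem_H0.mpr (Or.inl (mul_zero f))
  rcases eq_or_ne f 0 with rfl | hf0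
  · exact C.mem_H0.mpr (Or.inl (zero_mul g))
  rcases eq_or_ne g 0 with rfl | hg0
  · exact C.mem_H0.mpr (Or.inl (mul_zero f))
  refine C.mem_H0.mpr (Or.inr fun P => ?_)
  rw [C.ord_mul P f g hf0 hg0, Finsupp.add_apply]
  have := hf P; have := hg P; omega

/-- Multiplication of sections, `H⁰(D) ⊗ H⁰(E) → H⁰(D + E)`, as a bilinear map. -/
def mulH0 (D E : C.Div) : C.H0 D →ₗ[ℂ] C.H0 E →ₗ[ℂ] C.H0 (D + E) :=
  LinearMap.mk₂ ℂ (fun f g => ⟨(f : C.F) * (g : C.F), C.mul_mem_H0 f.2 g.2⟩)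
    (fun f f' g => Subtype.ext (by simp [add_mul]))
    (fun c f g => Subtype.ext (by simp [smul_mul_assoc]))
    (fun f g g' => Subtype.ext (by simp [mul_add]))
    (fun c f g => Subtype.ext (by simp [mul_smul_comm]))

/-- Transport of `H⁰` along an equality of divisors. -/
def castH0 {D E : C.Div} (h : D = E) : (C.H0 D : Type) ≃ₗ[ℂ] C.H0 E :=
  LinearEquiv.ofEq _ _ (by rw [h])

/-- The multiplication map `H⁰(D) ⊗ H⁰(E) → H⁰(G)` for `G = D + E`. -/
def mulTo (D E G : C.Div) (h : D + E = G) : (C.H0 D ⊗[ℂ] C.H0 E) →ₗ[ℂ] C.H0 G :=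
  (C.castH0 h).toLinearMap ∘ₗ TensorProduct.lift (C.mulH0 D E)

/-- The inclusion `H⁰(D) ⊆ H⁰(E)` for `D ≤ E`. -/
def inclH0 {D E : C.Div} (h : ∀ P, D P ≤ E P) : (C.H0 D : Type) →ₗ[ℂ] C.H0 E :=
  Submodule.inclusion (C.H0_mono h)

/-- Multiplication by a fixed section `a ∈ H⁰(E)`, as a map `H⁰(M) → H⁰(E + M)`. -/
def mulBy {E : C.Div} (a : C.F) (ha : a ∈ C.H0 E) (M : C.Div) :
    (C.H0 M : Type) →ₗ[ℂ] C.H0 (E + M) :=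
  C.mulH0 E M ⟨a, ha⟩

/-- The reduced effective divisor attached to a finite set of points. -/
def divOfFinset (s : Finset C.Point) : C.Div := ∑ P ∈ s, C.pt P

/-- The divisor of a nonzero rational function. -/
def divOf (f : C.F) : C.Div := by
  classical
  exact if h : f = 0 then 0
    else Finsupp.ofSupportFinite (fun P => C.ord P f) (C.ord_finite_support f h)

/-- Linear equivalence of divisors. -/
def LinEquiv (D E : C.Div) : Prop := ∃ f : C.F, f ≠ 0 ∧ D - E = C.divOf f

end PreCurve

/-- A smooth connected projective complex curve: the data of `PreCurve` together with
properness (principal divisors have degree zero), finite–dimensionality of Riemann–Roch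
spaces, `H⁰(O) = ℂ`, a canonical divisor `K`, and the genus, tied together by the
Riemann–Roch theorem (in its Serre-duality form `h⁰(D) − h⁰(K−D) = deg D + 1 − g`). -/
structure Curve extends PreCurve where
  deg_principal : ∀ f : toPreCurve.F, f ≠ 0 → (∑ᶠ P, toPreCurve.ord P f) = 0
  finiteDim : ∀ D : toPreCurve.Div, FiniteDimensional ℂ (toPreCurve.H0 D)
  h0_triv : toPreCurve.h0 0 = 1
  /-- a canonical divisor (class) of the curve -/
  K : toPreCurve.Div
  /-- the genus of the curve -/
  genus : ℕ
  riemann_roch : ∀ D : toPreCurve.Div,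
    (toPreCurve.h0 D : ℤ) - toPreCurve.h0 (K - D) = toPreCurve.deg D + 1 - genus

namespace Curve

variable (C : Curve)

/-- `h¹(D)`, via Serre duality. -/
def h1 (D : C.Div) : ℕ := C.h0 (C.K - D)

/-- The complete linear system `|D|` is base-point free. -/
def BasePointFree (D : C.Div) : Prop := ∀ P : C.Point, C.h0 (D - C.pt P) + 1 = C.h0 D

/-- `|D|` is a base-point-free pencil (base-point free of projective dimension 1). -/
def IsBPFPencil (D : C.Div) : Prop := C.BasePointFree D ∧ C.h0 D = 2

/-- `C` is hyperelliptic: it carries a `g¹₂`. -/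
def Hyperelliptic : Prop := ∃ D : C.Div, C.deg D = 2 ∧ 2 ≤ C.h0 D

/-- `C` is trigonal: it admits a degree-3 map to `ℙ¹`. -/
def Trigonal : Prop := ∃ D : C.Div, C.deg D = 3 ∧ 2 ≤ C.h0 D ∧ C.BasePointFree D

/-- `D` is very ample (it separates points and tangent vectors). -/
def VeryAmple (D : C.Div) : Prop :=
  ∀ P Q : C.Point, C.h0 (D - C.pt P - C.pt Q) + 2 = C.h0 D

/-- `C` is a smooth plane quintic: it carries a very ample `g²₅`. -/
def IsPlaneQuintic : Prop := ∃ D : C.Div, C.deg D = 5 ∧ C.h0 D = 3 ∧ C.VeryAmple D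

/-- The homogeneous coordinate algebra `R_L = ⊕ₙ H⁰(C, Lⁿ)` of a divisor (class) `L`,
as a graded system inside the function field. -/
def RL (L : C.Div) : GradedSystem ℂ C.F where
  piece n := C.H0 (n • L)
  one_mem := by
    refine C.mem_H0.mpr (Or.inr fun P => ?_)
    have h1 : C.ord P 1 = 0 := by
      simpa using C.ord_algebraMap P 1 one_ne_zero
    simp [h1]
  mul_mem := by
    intro m n x y hx hy
    have h := C.mul_mem_H0 hx hy
    show x * y ∈ C.H0 ((m + n) • L)
    rwa [add_smul]

/-- The embedding given by the complete linear system `|L|` is projectively normal: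
`R_L` is generated in degree one (equivalently, `Symⁿ H⁰(L) → H⁰(Lⁿ)` is surjective
for all `n`). -/
def ProjectivelyNormal (L : C.Div) : Prop :=
  ∀ n : ℕ, Surjective
    (C.mulTo L (n • L) ((n + 1) • L) ((add_comm L (n • L)).trans (succ_nsmul L n).symm))

end Curve

/-- The homology of a (two-step) complex `X → Y → Z` at `Y`. -/
def homol {X Y Z : Type} [AddCommGroup X] [AddCommGroup Y] [AddCommGroup Z]
    [Module ℂ X] [Module ℂ Y] [Module ℂ Z] (f : X →ₗ[ℂ] Y) (g : Y →ₗ[ℂ] Z) : Type :=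
  ↥(LinearMap.ker g) ⧸ Submodule.comap (LinearMap.ker g).subtype (LinearMap.range f)


namespace PreCurve

variable (C : PreCurve)

theorem deg_add (D E : C.Div) : C.deg (D + E) = C.deg D + C.deg E :=
  Finsupp.sum_add_index' (fun _ => rfl) fun _ _ _ => rfl

theorem deg_pt (P : C.Point) : C.deg (C.pt P) = 1 :=
  Finsupp.sum_single_index rfl

theorem deg_divOfFinset (s : Finset C.Point) : C.deg (C.divOfFinset s) = s.card := by
  classical
  induction s using Finset.induction_on with
  | empty => simp [divOfFinset, deg]
  | insert P s hP ih =>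
    have h : C.divOfFinset (insert P s) = C.pt P + C.divOfFinset s := Finset.sum_insert hP
    rw [h, deg_add, deg_pt, ih, Finset.card_insert_of_notMem hP]
    push_cast
    ring

theorem pt_apply [DecidableEq C.Point] (P Q : C.Point) :
    C.pt P Q = if P = Q then 1 else 0 :=
  Finsupp.single_apply

theorem divOfFinset_apply [DecidableEq C.Point] (s : Finset C.Point) (Q : C.Point) :
    C.divOfFinset s Q = if Q ∈ s then 1 else 0 := by
  simp [divOfFinset, Finsupp.finsetSum_apply, pt_apply]

theorem H0_sub_pt_le (D : C.Div) (P : C.Point) : C.H0 (D - C.pt P) ≤ C.H0 D := by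
  classical
  refine C.H0_mono fun Q => ?_
  rw [Finsupp.sub_apply, pt_apply]
  split_ifs <;> omega

/-- A section of `D` is not a section of `D - P` iff its order at `P` is as small as possible. -/
theorem notMem_H0_sub_pt_iff {D : C.Div} {P : C.Point} {f : C.F} (hf : f ∈ C.H0 D) :
    f ∉ C.H0 (D - C.pt P) ↔ f ≠ 0 ∧ C.ord P f = -D P := by
  classical
  rw [mem_H0] at hf ⊢
  constructor
  · intro h
    push Not at h
    obtain ⟨h0, Q, hQ⟩ := h
    have hD := hf.resolve_left h0
    have hDQ := hD Q
    rw [Finsupp.sub_apply, pt_apply] at hQ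
    split_ifs at hQ with hPQ
    · subst hPQ
      exact ⟨h0, by omega⟩
    · omega
  · rintro ⟨h0, hP⟩ (h | h)
    · exact h0 h
    · have := h P
      rw [Finsupp.sub_apply, pt_apply, if_pos rfl] at this
      omega

theorem one_mem_H0_divOfFinset (s : Finset C.Point) : (1 : C.F) ∈ C.H0 (C.divOfFinset s) := by
  classical
  refine C.mem_H0.mpr (Or.inr fun P => ?_)
  have h1 : C.ord P 1 = 0 := by simpa using C.ord_algebraMap P 1 one_ne_zero
  rw [h1, divOfFinset_apply]
  split_ifs <;> norm_num

theorem coe_mulTo_tmul {D E G : C.Div} (h : D + E = G) (f : C.H0 D) (g : C.H0 E) :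
    (C.mulTo D E G h (f ⊗ₜ g) : C.F) = f * g := rfl

end PreCurve

namespace Curve

variable (C : Curve)

instance (D : C.Div) : FiniteDimensional ℂ (C.H0 D) := C.finiteDim D

theorem h0_le_h0_sub_pt_add_one (D : C.Div) (P : C.Point) :
    C.h0 D ≤ C.h0 (D - C.pt P) + 1 := by
  have hd := C.deg_add (D - C.pt P) (C.pt P)
  rw [sub_add_cancel, C.deg_pt] at hd
  have h1 := C.riemann_roch D
  have h2 := C.riemann_roch (D - C.pt P)
  have h3 : C.h0 (C.K - D) ≤ C.h0 (C.K - (D - C.pt P)) := by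
    have h := C.H0_sub_pt_le (C.K - (D - C.pt P)) P
    rw [show C.K - (D - C.pt P) - C.pt P = C.K - D by abel] at h
    exact Submodule.finrank_mono h
  omega

variable {C}

theorem VeryAmple.basePointFree {L : C.Div} (hL : C.VeryAmple L) : C.BasePointFree L := by
  intro P
  have h1 := hL P P
  have h2 := C.h0_le_h0_sub_pt_add_one L P
  have h3 := C.h0_le_h0_sub_pt_add_one (L - C.pt P) P
  omega

theorem BasePointFree.exists_notMem {D : C.Div} (hD : C.BasePointFree D) (P : C.Point) :
    ∃ f ∈ C.H0 D, f ∉ C.H0 (D - C.pt P) := by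
  by_contra! h
  have h1 : C.h0 D ≤ C.h0 (D - C.pt P) := Submodule.finrank_mono h
  have h2 := hD P
  omega

/-- The sum of two base-point-free divisors is base-point free. -/
theorem BasePointFree.add {D E : C.Div} (hD : C.BasePointFree D) (hE : C.BasePointFree E) :
    C.BasePointFree (D + E) := by
  intro P
  obtain ⟨f, hf, hfP⟩ := hD.exists_notMem P
  obtain ⟨g, hg, hgP⟩ := hE.exists_notMem P
  rw [C.notMem_H0_sub_pt_iff hf] at hfP
  rw [C.notMem_H0_sub_pt_iff hg] at hgP
  have hfg := C.mul_mem_H0 hf hg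
  have hfgP : f * g ∉ C.H0 (D + E - C.pt P) := by
    rw [C.notMem_H0_sub_pt_iff hfg, C.ord_mul P f g hfP.1 hgP.1, Finsupp.add_apply]
    exact ⟨mul_ne_zero hfP.1 hgP.1, by omega⟩
  have hlt : C.h0 (D + E - C.pt P) < C.h0 (D + E) :=
    Submodule.finrank_lt_finrank_of_lt
      (lt_of_le_of_ne (C.H0_sub_pt_le _ P) fun h => hfgP (h ▸ hfg))
  have := C.h0_le_h0_sub_pt_add_one (D + E) P
  omega

/-- A base-point-free linear system has a section vanishing at no point of a given finite set. -/
theorem BasePointFree.exists_forall_notMem {D : C.Div} (hD : C.BasePointFree D)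
    (s : Finset C.Point) : ∃ f ∈ C.H0 D, ∀ P ∈ s, f ∉ C.H0 (D - C.pt P) := by
  by_contra! h
  have hcover : ⋃ P : s, ((C.H0 (D - C.pt P)).comap (C.H0 D).subtype : Set (C.H0 D)) =
      Set.univ := by
    refine Set.eq_univ_of_forall fun f => ?_
    obtain ⟨P, hP, hfP⟩ := h f f.2
    exact Set.mem_iUnion.mpr ⟨⟨P, hP⟩, hfP⟩
  obtain ⟨P, hP⟩ := Subspace.exists_eq_top_of_iUnion_eq_univ hcover
  obtain ⟨f, hf, hfP⟩ := hD.exists_notMem P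
  exact hfP (Submodule.eq_top_iff'.mp hP ⟨f, hf⟩)

/-- The base-point-free pencil trick for the pencil spanned by `1` and `t` in `|D|`,
where `D` is reduced: if the dimensions allow it, `H⁰(E) + t H⁰(E)` is all of `H⁰(D + E)`. -/
theorem exists_add_mul_eq {s : Finset C.Point} {t : C.F}
    (ht : t ∈ C.H0 (C.divOfFinset s)) (hts : ∀ P ∈ s, t ∉ C.H0 (C.divOfFinset s - C.pt P))
    (E : C.Div) (hdim : C.h0 (C.divOfFinset s + E) + C.h0 (E - C.divOfFinset s) ≤ 2 * C.h0 E)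
    {u : C.F} (hu : u ∈ C.H0 (C.divOfFinset s + E)) :
    ∃ f ∈ C.H0 E, ∃ g ∈ C.H0 E, f + t * g = u := by
  classical
  let φ : C.H0 E × C.H0 E →ₗ[ℂ] C.F :=
    (C.H0 E).subtype.coprod (LinearMap.mulLeft ℂ t ∘ₗ (C.H0 E).subtype)
  have hφ (p : C.H0 E × C.H0 E) : φ p = p.1 + t * p.2 := rfl
  have hrange : LinearMap.range φ ≤ C.H0 (C.divOfFinset s + E) := by
    rintro _ ⟨p, rfl⟩
    have h1 := C.mul_mem_H0 (C.one_mem_H0_divOfFinset s) p.1.2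
    rw [one_mul] at h1
    exact add_mem h1 (C.mul_mem_H0 ht p.2.2)
  have hker (p : LinearMap.ker φ) : (p.1.2 : C.F) ∈ C.H0 (E - C.divOfFinset s) := by
    obtain ⟨⟨f, g⟩, hp⟩ := p
    rw [LinearMap.mem_ker, hφ] at hp
    change (f : C.F) + t * g = 0 at hp
    change (g : C.F) ∈ _
    by_cases hg0 : (g : C.F) = 0
    · rw [hg0]; exact zero_mem _
    refine C.mem_H0.mpr (Or.inr fun P => ?_)
    have hgE := (C.mem_H0.mp g.2).resolve_left hg0 P
    rw [Finsupp.sub_apply, C.divOfFinset_apply]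
    split_ifs with hP
    · obtain ⟨ht0, htP⟩ := (C.notMem_H0_sub_pt_iff ht).mp (hts P hP)
      rw [C.divOfFinset_apply, if_pos hP] at htP
      have htg : t * (g : C.F) ∈ C.H0 E := by
        rw [eq_neg_of_add_eq_zero_right hp]
        exact neg_mem f.2
      have := (C.mem_H0.mp htg).resolve_left (mul_ne_zero ht0 hg0) P
      rw [C.ord_mul P _ _ ht0 hg0] at this
      omega
    · omega
  let ψ : LinearMap.ker φ →ₗ[ℂ] C.H0 (E - C.divOfFinset s) :=
    LinearMap.codRestrict _
      ((C.H0 E).subtype ∘ₗ LinearMap.snd ℂ _ _ ∘ₗ (LinearMap.ker φ).subtype) hker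
  have hψ : Injective ψ := by
    rw [injective_iff_map_eq_zero]
    rintro ⟨⟨f, g⟩, hp⟩ h
    have hg : (g : C.F) = 0 := congrArg Subtype.val h
    rw [LinearMap.mem_ker, hφ] at hp
    change (f : C.F) + t * g = 0 at hp
    rw [hg, mul_zero, add_zero] at hp
    exact Subtype.ext (Prod.ext (Subtype.ext hp) (Subtype.ext hg))
  have hkerdim : Module.finrank ℂ (LinearMap.ker φ) ≤ C.h0 (E - C.divOfFinset s) :=
    LinearMap.finrank_le_finrank_of_injective hψ
  have hrk := LinearMap.finrank_range_add_finrank_ker φ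
  rw [Module.finrank_prod] at hrk
  have hE : Module.finrank ℂ (C.H0 E) = C.h0 E := rfl
  have hle : Module.finrank ℂ (C.H0 (C.divOfFinset s + E)) ≤
      Module.finrank ℂ (LinearMap.range φ) := by
    change C.h0 (C.divOfFinset s + E) ≤ _
    omega
  rw [← Submodule.eq_of_le_of_finrank_le hrange hle] at hu
  obtain ⟨p, rfl⟩ := hu
  exact ⟨p.1, p.1.2, p.2, p.2.2, rfl⟩

/-- If `D` is reduced, effective and base-point free, then `H⁰(D) ⊗ H⁰(E) → H⁰(D + E)` is
surjective as soon as the bound of the base-point-free pencil trick allows it. -/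
theorem mulTo_surjective {s : Finset C.Point} {D : C.Div} (hD : D = C.divOfFinset s)
    (hbpf : C.BasePointFree D) {E G : C.Div} (h : D + E = G)
    (hdim : C.h0 G + C.h0 (E - D) ≤ 2 * C.h0 E) :
    Surjective (C.mulTo D E G h) := by
  subst h hD
  obtain ⟨t, ht, hts⟩ := hbpf.exists_forall_notMem s
  intro u
  obtain ⟨f, hf, g, hg, hfg⟩ := exists_add_mul_eq ht hts E hdim u.2
  refine ⟨⟨1, C.one_mem_H0_divOfFinset s⟩ ⊗ₜ ⟨f, hf⟩ + ⟨t, ht⟩ ⊗ₜ ⟨g, hg⟩, Subtype.ext ?_⟩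
  rw [map_add, Submodule.coe_add, C.coe_mulTo_tmul, C.coe_mulTo_tmul, one_mul]
  exact hfg

theorem mulTo_comm_surjective {D E G : C.Div} {h : D + E = G} {h' : E + D = G}
    (hsurj : Surjective (C.mulTo D E G h)) : Surjective (C.mulTo E D G h') := by
  have hcomm : C.mulTo E D G h' ∘ₗ (TensorProduct.comm ℂ (C.H0 D) (C.H0 E)).toLinearMap =
      C.mulTo D E G h :=
    TensorProduct.ext' fun f g => Subtype.ext (mul_comm (g : C.F) f)
  rw [← hcomm, LinearMap.coe_comp] at hsurj
  exact hsurj.of_comp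

theorem finrank_ker_mulTo_add {D E G : C.Div} {h : D + E = G}
    (hsurj : Surjective (C.mulTo D E G h)) :
    Module.finrank ℂ (LinearMap.ker (C.mulTo D E G h)) + C.h0 G = C.h0 D * C.h0 E := by
  have hrk := LinearMap.finrank_range_add_finrank_ker (V := C.H0 D ⊗[ℂ] C.H0 E)
    (C.mulTo D E G h)
  rw [LinearMap.range_eq_top.mpr hsurj, finrank_top, Module.finrank_tensorProduct] at hrk
  rw [add_comm]
  exact hrk

end Curve

/-!  ### STATEMENT 8

Under the hypotheses of the main theorem (statement 5): (1) the multiplication map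
`H⁰(L) ⊗ H⁰(D) → H⁰(L(D))` is surjective; (2) the bundle `M_D ⊗ L` is globally
generated, where `M_D = ker (H⁰(D) ⊗ O_C → O(D))`.

Global generation of `M_D ⊗ L` is expressed through the standard equivalence:
a vector bundle `E` on a curve is globally generated iff `h⁰(E(-x)) = h⁰(E) - rk E`
for every point `x`; moreover `H⁰((M_D ⊗ L)(-x)) = ker (H⁰(D) ⊗ H⁰(L(-x)) → H⁰(L(D)(-x)))`
and `H⁰(M_D ⊗ L) = ker (H⁰(D) ⊗ H⁰(L) → H⁰(L(D)))` (left exactness of global sections),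
and `rk (M_D ⊗ L) = h⁰(D) - 1`. -/
theorem surjective_and_globally_generated (C : Curve) (L : C.Div)
    (hVA : C.VeryAmple L) (hdegL : (C.genus : ℤ) + 3 ≤ C.deg L)
    (hPN : C.ProjectivelyNormal L)
    (Pts : Finset C.Point) (D : C.Div) (hD : D = C.divOfFinset Pts)
    (hcard : (Pts.card : ℤ) = C.deg L - C.genus - 1 + 2 * C.h1 L)
    (hDbpf : C.BasePointFree D)
    (hDdim : (C.h0 D : ℤ) = C.deg L - 2 * C.genus + 4 * C.h1 L)
    (hLD : C.IsBPFPencil (L - D))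
    (h1LD : C.h1 (L + D) = 0) (h1LLD : C.h1 (2 • L - D) = 0)
    (hind : ∀ s : Finset C.Point, s ⊆ Pts → s.card = C.h1 L →
      C.h0 (C.K - L + D - C.divOfFinset s) + C.h1 L = C.h0 (C.K - L + D)) :
    Surjective (C.mulTo L D (L + D) rfl) ∧
    ∀ x : C.Point,
      Module.finrank ℂ
          (LinearMap.ker (C.mulTo D (L - C.pt x) (D + L - C.pt x)
            (add_sub_assoc D L (C.pt x)).symm)) + C.h0 D =
        Module.finrank ℂ (LinearMap.ker (C.mulTo D L (D + L) rfl)) + 1 := by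
  have hLbpf := hVA.basePointFree
  have hdegD : C.deg D = Pts.card := by rw [hD, C.deg_divOfFinset]
  have hrrL := C.riemann_roch L
  have hrrLD := C.riemann_roch (L + D)
  rw [C.deg_add] at hrrLD
  unfold Curve.h1 at h1LD hcard
  have hLD2 := hLD.2
  have hLDD : C.h0 (D + L) = C.h0 (L + D) := by rw [add_comm]
  have hsurj : Surjective (C.mulTo D L (D + L) rfl) :=
    Curve.mulTo_surjective hD hDbpf rfl (by omega)
  have hsurj' : Surjective (C.mulTo D L (L + D) (add_comm D L)) :=
    Curve.mulTo_surjective hD hDbpf (add_comm D L) (by omega)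
  refine ⟨Curve.mulTo_comm_surjective hsurj', fun x => ?_⟩
  have hLx := hLbpf x
  have hDLx := hDbpf.add hLbpf x
  have hLDx := hLD.1 x
  rw [sub_right_comm] at hLDx
  have hsurjx : Surjective (C.mulTo D (L - C.pt x) (D + L - C.pt x)
      (add_sub_assoc D L (C.pt x)).symm) :=
    Curve.mulTo_surjective hD hDbpf _ (by omega)
  have hker := Curve.finrank_ker_mulTo_add hsurj
  have hkerx := Curve.finrank_ker_mulTo_add hsurjx
  rw [← hLx, mul_add, mul_one] at hker
  omega

end
end

section
/- Let C be a non-hyperelliptic smooth connected projective complex curve of genus g and D a divisor of degree g-1 such that |D| and |K(-D)| are base-point-free pencils. Let V = H^0(K(-D)) ⊂ H^0(K) = (R_K)_1. Then the ideal I = ⊕_{n≥1} H^0(K^n(-D)) of the canonical algebra R_K is generated over R_K by its degree-1 component V; consequently R_K/(V·R_K) is the homogeneous coordinate algebra of the g-1 points of any reduced divisor in |D| under the canonical embedding. -/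
open TensorProduct Function

noncomputable section


namespace PreCurve

variable (C : PreCurve)

theorem deg_zero : C.deg 0 = 0 := Finsupp.sum_zero_index

theorem deg_sub (D E : C.Div) : C.deg (D - E) = C.deg D - C.deg E := by
  have h := C.deg_add (D - E) E
  rw [sub_add_cancel] at h
  omega

theorem deg_nsmul (n : ℕ) (D : C.Div) : C.deg (n • D) = n * C.deg D := by
  induction n with
  | zero => simp [deg_zero]
  | succ n ih => rw [succ_nsmul, deg_add, ih]; push_cast; ring

theorem deg_eq_finsum (D : C.Div) : C.deg D = ∑ᶠ P, D P :=
  (finsum_eq_sum_of_support_subset _ (by simp)).symm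

end PreCurve

namespace Curve

variable (C : Curve)

theorem h0_eq_zero_of_deg_neg {D : C.Div} (hD : C.deg D < 0) : C.h0 D = 0 := by
  have hbot : C.H0 D = ⊥ := by
    refine (Submodule.eq_bot_iff _).mpr fun f hf => ?_
    by_contra hf0
    have hnn : ∀ P, 0 ≤ C.ord P f + D P := (C.mem_H0.mp hf).resolve_left hf0
    have hsum : 0 ≤ ∑ᶠ P, (C.ord P f + D P) := finsum_nonneg hnn
    rw [finsum_add_distrib (C.ord_finite_support f hf0) D.hasFiniteSupport,
      C.deg_principal f hf0, ← C.deg_eq_finsum] at hsum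
    omega
  rw [PreCurve.h0, hbot, finrank_bot]

theorem h0_K : C.h0 C.K = C.genus := by
  have h := C.riemann_roch 0
  rw [sub_zero, C.h0_triv, C.deg_zero] at h
  omega

theorem deg_K : C.deg C.K = 2 * C.genus - 2 := by
  have h := C.riemann_roch C.K
  rw [sub_self, C.h0_triv, C.h0_K] at h
  push_cast at h
  omega

theorem h0_eq_of_deg_gt {D : C.Div} (hD : C.deg C.K < C.deg D) :
    (C.h0 D : ℤ) = C.deg D + 1 - C.genus := by
  have h := C.riemann_roch D
  rw [C.h0_eq_zero_of_deg_neg (D := C.K - D) (by rw [C.deg_sub]; omega)] at h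
  simpa using h

/-- At each point, some member of a basis of a base-point-free pencil generates. -/
theorem ord_eq_or_ord_eq_of_basePointFree {E : C.Div} (hE : C.BasePointFree E)
    (b : Module.Basis (Fin 2) ℂ (C.H0 E)) (P : C.Point) :
    C.ord P (b 0 : C.F) = -E P ∨ C.ord P (b 1 : C.F) = -E P := by
  classical
  by_contra! hne
  have hmem : ∀ i, (b i : C.F) ∈ C.H0 (E - C.pt P) := by
    intro i
    have hi0 : (b i : C.F) ≠ 0 := fun h => b.ne_zero i (Subtype.ext h)
    have hi := (C.mem_H0.mp (b i).2).resolve_left hi0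
    have hiP : C.ord P (b i : C.F) ≠ -E P := by
      fin_cases i
      exacts [hne.1, hne.2]
    refine C.mem_H0.mpr (Or.inr fun Q => ?_)
    have hQ := hi Q
    rw [Finsupp.sub_apply, PreCurve.pt, Finsupp.single_apply]
    split_ifs with h
    · subst h; omega
    · omega
  have hle : C.H0 E ≤ C.H0 (E - C.pt P) := by
    intro f hf
    have hrepr := congrArg Subtype.val (b.sum_repr ⟨f, hf⟩)
    rw [← show _ = f from hrepr, Fin.sum_univ_two]
    exact add_mem (Submodule.smul_mem _ _ (hmem 0)) (Submodule.smul_mem _ _ (hmem 1))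
  have := C.finiteDim (E - C.pt P)
  have hfin : C.h0 E ≤ C.h0 (E - C.pt P) := Submodule.finrank_mono hle
  have := hE P
  omega

/-- The base-point-free pencil trick: the kernel of `H⁰(E) ⊗ H⁰(M) → H⁰(E + M)` has dimension
at most `h⁰(M - E)`, so the map is onto as soon as the dimensions allow it. -/
theorem surjective_mulTo_of_isBPFPencil {E M G : C.Div} (h : E + M = G) (hE : C.IsBPFPencil E)
    (hdim : C.h0 G + C.h0 (M - E) ≤ 2 * C.h0 M) : Surjective (C.mulTo E M G h) := by
  have := C.finiteDim
  let b : Module.Basis (Fin 2) ℂ (C.H0 E) := Module.finBasisOfFinrankEq ℂ _ hE.2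
  have hb0 : ∀ i, (b i : C.F) ≠ 0 := fun i h => b.ne_zero i (Subtype.ext h)
  let L : (C.H0 M × C.H0 M) →ₗ[ℂ] C.H0 G :=
    (C.mulTo E M G h ∘ₗ TensorProduct.mk ℂ _ _ (b 0)).coprod
      (C.mulTo E M G h ∘ₗ TensorProduct.mk ℂ _ _ (b 1))
  have hL : ∀ x, (L x : C.F) = b 0 * x.1 + b 1 * x.2 := fun _ => rfl
  have hrel : ∀ {u v}, (u, v) ∈ LinearMap.ker L → (b 0 : C.F) * u + b 1 * v = 0 := by
    intro u v hx
    rw [← hL (u, v), LinearMap.mem_ker.mp hx]; rfl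
  have hquot : ∀ x : LinearMap.ker L, (x.1.1 : C.F) * (b 1 : C.F)⁻¹ ∈ C.H0 (M - E) := by
    rintro ⟨⟨u, v⟩, hx⟩
    have huv := hrel hx
    set c : C.F := (u : C.F) * (b 1 : C.F)⁻¹ with hc
    have hu : (u : C.F) = c * b 1 := by rw [hc, inv_mul_cancel_right₀ (hb0 1)]
    have hv : (v : C.F) = -c * b 0 := by
      apply mul_left_cancel₀ (hb0 1)
      rw [hu] at huv
      linear_combination huv
    refine C.mem_H0.mpr (or_iff_not_imp_left.mpr fun hc0 P => ?_)
    have key : ∀ (d : C.F) (w : C.H0 M) (i : Fin 2), d ≠ 0 → (w : C.F) = d * b i →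
        C.ord P (b i : C.F) = -E P → 0 ≤ C.ord P d + (M - E) P := by
      intro d w i hd hw hi
      have hw0 : (w : C.F) ≠ 0 := hw ▸ mul_ne_zero hd (hb0 i)
      have hwP := (C.mem_H0.mp w.2).resolve_left hw0 P
      rw [hw, C.ord_mul P _ _ hd (hb0 i), hi] at hwP
      rw [Finsupp.sub_apply]
      omega
    rcases C.ord_eq_or_ord_eq_of_basePointFree hE.1 b P with h0 | h1
    · have hneg : C.ord P (-c) = C.ord P c := by
        have hmul := C.ord_mul P (algebraMap ℂ C.F (-1)) c (by simp) hc0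
        rw [C.ord_algebraMap P (-1) (by simp)] at hmul
        simpa using hmul
      exact hneg ▸ key (-c) v 0 (neg_ne_zero.mpr hc0) hv h0
    · exact key c u 1 hc0 hu h1
  let q : LinearMap.ker L →ₗ[ℂ] C.H0 (M - E) :=
    { toFun := fun x => ⟨(x.1.1 : C.F) * (b 1 : C.F)⁻¹, hquot x⟩
      map_add' := fun x y => Subtype.ext (by simp [add_mul])
      map_smul' := fun r x => Subtype.ext (by simp) }
  have hq : Injective q := by
    rintro ⟨⟨u, v⟩, hx⟩ ⟨⟨u', v'⟩, hy⟩ hxy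
    have hu : (u : C.F) = u' :=
      mul_right_cancel₀ (inv_ne_zero (hb0 1)) (congrArg Subtype.val hxy)
    have hv : (v : C.F) = v' := by
      have huv := hrel hx
      rw [hu, ← hrel hy] at huv
      exact mul_left_cancel₀ (hb0 1) (add_left_cancel huv)
    exact Subtype.ext (Prod.ext (Subtype.ext hu) (Subtype.ext hv))
  have hker : Module.finrank ℂ (LinearMap.ker L) ≤ C.h0 (M - E) :=
    LinearMap.finrank_le_finrank_of_injective hq
  have hrank := L.finrank_range_add_finrank_ker
  rw [Module.finrank_prod] at hrank
  have htop : LinearMap.range L = ⊤ := by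
    refine Submodule.eq_top_of_finrank_eq (le_antisymm (Submodule.finrank_le _) ?_)
    simp only [PreCurve.h0] at hdim hker
    omega
  intro y
  obtain ⟨x, rfl⟩ := LinearMap.range_eq_top.mp htop y
  exact ⟨b 0 ⊗ₜ x.1 + b 1 ⊗ₜ x.2, map_add _ _ _⟩

theorem one_lt_genus {D : C.Div} (hD : ∀ P, 0 ≤ D P) (hdeg : C.deg D = (C.genus : ℤ) - 1)
    (h0D : C.h0 D = 2) : 1 < C.genus := by
  have hnn : 0 ≤ C.deg D := Finset.sum_nonneg fun P _ => hD P
  by_contra hg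
  have hsum : ∑ P ∈ D.support, D P = 0 := show C.deg D = 0 by omega
  have hzero : D = 0 := by
    ext P
    by_contra hP
    exact hP ((Finset.sum_eq_zero_iff_of_nonneg fun Q _ => hD Q).mp hsum P
      (Finsupp.mem_support_iff.mpr hP))
  rw [hzero, C.h0_triv] at h0D
  omega

theorem h0_add_h0_eq_two_mul_h0 {D : C.Div} (hg : 1 < C.genus)
    (hdeg : C.deg D = (C.genus : ℤ) - 1) (h0D : C.h0 D = 2) (h0KD : C.h0 (C.K - D) = 2) (n : ℕ) :
    C.h0 ((n + 1) • C.K - D) + C.h0 (n • C.K - (C.K - D)) = 2 * C.h0 (n • C.K) := by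
  have hK := C.deg_K
  rcases n with _ | _ | n
  · have hneg : C.h0 (0 - (C.K - D)) = 0 :=
      C.h0_eq_zero_of_deg_neg (by rw [C.deg_sub, C.deg_sub, C.deg_zero]; omega)
    simp only [zero_add, one_nsmul, zero_nsmul, hneg, h0KD, C.h0_triv]
  · have hdeg2 : C.deg ((1 + 1) • C.K - D) = 3 * (C.genus - 1) := by
      rw [C.deg_sub, C.deg_nsmul, hK, hdeg]; push_cast; ring
    have h2 := C.h0_eq_of_deg_gt (D := (1 + 1) • C.K - D) (by omega)
    simp only [zero_add, one_nsmul, sub_sub_cancel, h0D, C.h0_K]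
    omega
  · have hn : (0 : ℤ) ≤ n * (C.genus - 1) := mul_nonneg (by positivity) (by omega)
    have d1 : C.deg ((n + 1 + 1 + 1) • C.K - D) = 2 * (n * (C.genus - 1)) + 5 * (C.genus - 1) := by
      rw [C.deg_sub, C.deg_nsmul, hK, hdeg]; push_cast; ring
    have d2 : C.deg ((n + 1 + 1) • C.K - (C.K - D)) =
        2 * (n * (C.genus - 1)) + 3 * (C.genus - 1) := by
      rw [C.deg_sub, C.deg_sub, C.deg_nsmul, hK, hdeg]; push_cast; ring
    have d3 : C.deg ((n + 1 + 1) • C.K) = 2 * (n * (C.genus - 1)) + 4 * (C.genus - 1) := by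
      rw [C.deg_nsmul, hK]; push_cast; ring
    have e1 := C.h0_eq_of_deg_gt (D := (n + 1 + 1 + 1) • C.K - D) (by omega)
    have e2 := C.h0_eq_of_deg_gt (D := (n + 1 + 1) • C.K - (C.K - D)) (by omega)
    have e3 := C.h0_eq_of_deg_gt (D := (n + 1 + 1) • C.K) (by omega)
    omega

end Curve

/-!  ### STATEMENT 10

Let `C` be a non-hyperelliptic smooth connected projective complex curve of genus `g`
and `D` a divisor of degree `g-1` such that `|D|` and `|K(-D)|` are base-point-free
pencils; let `V = H⁰(K(-D)) ⊆ H⁰(K)`.  Then the ideal `I = ⊕_{n≥1} H⁰(Kⁿ(-D))` of the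
canonical algebra `R_K` is generated over `R_K` by its degree-one part `V`
(first conclusion: `V · H⁰(Kⁿ) = H⁰(K^{n+1}(-D))` for all `n`); consequently
`R_K/(V·R_K)` is the homogeneous coordinate algebra of the `g-1` points of a reduced
divisor in `|D|` (second conclusion: taking, as one may, `D` itself to be the reduced
divisor `P₁ + ⋯ + P_{g-1}`, the image of `V ⊗ H⁰(Kⁿ)` inside `H⁰(K^{n+1})` is exactly
the space of sections vanishing on the points, i.e. the degree-`(n+1)` part of the
homogeneous ideal of the point set in the canonical embedding). -/
theorem ideal_generated_by_V (C : Curve) (hHE : ¬ C.Hyperelliptic)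
    (Pts : Finset C.Point) (hcard : (Pts.card : ℤ) = (C.genus : ℤ) - 1)
    (D : C.Div) (hD : D = C.divOfFinset Pts) (hDeff : ∀ P, 0 ≤ D P)
    (hdeg : C.deg D = (C.genus : ℤ) - 1)
    (hDp : C.IsBPFPencil D) (hKD : C.IsBPFPencil (C.K - D)) :
    (∀ n : ℕ, Surjective
      (C.mulTo (C.K - D) (n • C.K) ((n + 1) • C.K - D)
        (by rw [succ_nsmul]; abel))) ∧
    (∀ n : ℕ,
      LinearMap.range
          ((C.inclH0 (fun P => by
              have h := hDeff P
              rw [Finsupp.sub_apply]; omega)) ∘ₗ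
            (C.mulTo (C.K - D) (n • C.K) ((n + 1) • C.K - D) (by rw [succ_nsmul]; abel))) =
        Submodule.comap (C.H0 ((n + 1) • C.K)).subtype (C.H0 ((n + 1) • C.K - D))) := by
  have hsurj : ∀ n : ℕ, Surjective
      (C.mulTo (C.K - D) (n • C.K) ((n + 1) • C.K - D) (by rw [succ_nsmul]; abel)) := fun n =>
    C.surjective_mulTo_of_isBPFPencil _ hKD
      (C.h0_add_h0_eq_two_mul_h0 (C.one_lt_genus hDeff hdeg hDp.2) hdeg hDp.2 hKD.2 n).le
  refine ⟨hsurj, fun n => ?_⟩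
  rw [LinearMap.range_comp_of_range_eq_top _ (LinearMap.range_eq_top.mpr (hsurj n))]
  exact Submodule.range_inclusion _ _ _

end
end
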